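/- Let a and b be natural numbers and N = 2(a+b)+7. If gcd(a+1, N) = 1 and gcd(a+3, N) = 1, then the kernel of the circulant matrix H_z over F_2 consists exactly of the zero vector and the all-ones vector: for every v : ZMod N → F_2 with H_z *ᵥ v = 0, either v = 0 or v i = 1 for all i. (Thus the quantum XYZ cyclic code C(a,b) has repetition code structure under pure Pauli X noise.) -/

import Mathlib

open Matrix

instance (n : ℕ) : NeZero (2 * n + 7) := ⟨by omega⟩

/-- The circulant parity-check matrix `H_z` of the quantum XYZ cyclic code `C(a,b)`,
whose symbol is the indicator function of `{b+1, a+b+2, a+b+4, 2a+b+5} ⊆ ZMod (2(a+b)+7)`. -/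
def Hz (a b : ℕ) : Matrix (ZMod (2 * (a + b) + 7)) (ZMod (2 * (a + b) + 7)) (ZMod 2) :=
  Matrix.circulant fun i =>
    if i ∈ ({((b + 1 : ℕ) : ZMod (2 * (a + b) + 7)), ((a + b + 2 : ℕ) : ZMod (2 * (a + b) + 7)),
        ((a + b + 4 : ℕ) : ZMod (2 * (a + b) + 7)),
        ((2 * a + b + 5 : ℕ) : ZMod (2 * (a + b) + 7))} : Finset (ZMod (2 * (a + b) + 7)))
    then 1 else 0

theorem Matrix.circulant_indicator_mulVec {G R : Type*} [AddCommGroup G] [Fintype G]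
    [DecidableEq G] [NonAssocSemiring R] (s : Finset G) (v : G → R) (i : G) :
    (Matrix.circulant (fun k => if k ∈ s then (1 : R) else 0) *ᵥ v) i = ∑ k ∈ s, v (i - k) := by
  rw [Matrix.mulVec, dotProduct, ← (Equiv.subLeft i).sum_comp]
  simp [Matrix.circulant_apply]

theorem ZMod.eq_of_forall_add_eq_of_coprime {α : Type*} {n d : ℕ} [NeZero n]
    (hd : Nat.Coprime d n) {f : ZMod n → α} (hf : ∀ i, f (i + d) = f i) (i : ZMod n) :
    f i = f 0 := by
  have key : ∀ k : ℕ, f (k * d) = f 0 := by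
    intro k
    induction k with
    | zero => simp
    | succ k ih => rw [← ih, ← hf (k * d)]; push_cast; ring_nf
  have hi : i = ((i * (d : ZMod n)⁻¹).val : ZMod n) * d := by
    rw [ZMod.natCast_zmod_val, mul_assoc, mul_comm _ (d : ZMod n),
      ZMod.coe_mul_inv_eq_one d hd, mul_one]
  rw [hi, key]

theorem ZMod.natCast_ne_natCast_of_lt {n k l : ℕ} (hk : k < n) (hl : l < n) (h : k ≠ l) :
    (k : ZMod n) ≠ l := by
  rwa [Ne, ZMod.natCast_eq_natCast_iff', Nat.mod_eq_of_lt hk, Nat.mod_eq_of_lt hl]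

theorem Hz_mulVec_apply (a b : ℕ) (v : ZMod (2 * (a + b) + 7) → ZMod 2)
    (i : ZMod (2 * (a + b) + 7)) :
    (Hz a b *ᵥ v) i = v (i - (b + 1 : ℕ)) + (v (i - (a + b + 2 : ℕ)) +
      (v (i - (a + b + 4 : ℕ)) + v (i - (2 * a + b + 5 : ℕ)))) := by
  have ne {k l : ℕ} (hk : k < 2 * (a + b) + 7) (hl : l < 2 * (a + b) + 7) (h : k ≠ l) :
      (k : ZMod (2 * (a + b) + 7)) ≠ l := ZMod.natCast_ne_natCast_of_lt hk hl h
  rw [Hz, Matrix.circulant_indicator_mulVec, Finset.sum_insert, Finset.sum_insert,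
    Finset.sum_insert, Finset.sum_singleton]
  all_goals
    simp only [Finset.mem_insert, Finset.mem_singleton, not_or]
    repeat' apply And.intro
    all_goals exact ne (by omega) (by omega) (by omega)

/-- If `gcd(a+1, N) = 1` and `gcd(a+3, N) = 1` (`N = 2(a+b)+7`), the kernel of `H_z`
over `F_2` consists exactly of the zero vector and the all-ones vector: the quantum XYZ
cyclic code `C(a,b)` has repetition code structure under pure Pauli `X` noise. -/
theorem xyz_repetition_structure_pauliX (a b : ℕ)
    (h1 : Nat.gcd (a + 1) (2 * (a + b) + 7) = 1)
    (h2 : Nat.gcd (a + 3) (2 * (a + b) + 7) = 1) :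
    ∀ v : ZMod (2 * (a + b) + 7) → ZMod 2,
      Hz a b *ᵥ v = 0 → v = 0 ∨ ∀ i, v i = 1 := by
  intro v hv
  have hw : ∀ j, v (j + (a + 1 : ℕ)) + v (j + (a + 1 : ℕ) + (a + 3 : ℕ)) =
      v j + v (j + (a + 3 : ℕ)) := by
    intro j
    have h := congrFun hv (j + (2 * a + b + 5 : ℕ))
    rw [Hz_mulVec_apply, Pi.zero_apply] at h
    have e1 : j + (2 * a + b + 5 : ℕ) - (b + 1 : ℕ) = j + (a + 1 : ℕ) + (a + 3 : ℕ) := by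
      push_cast; ring
    have e2 : j + (2 * a + b + 5 : ℕ) - (a + b + 2 : ℕ) = j + (a + 3 : ℕ) := by
      push_cast; ring
    have e3 : j + (2 * a + b + 5 : ℕ) - (a + b + 4 : ℕ) = j + (a + 1 : ℕ) := by
      push_cast; ring
    rw [e1, e2, e3, add_sub_cancel_right] at h
    rw [← CharTwo.add_eq_zero, ← h]
    ring
  have hconst := ZMod.eq_of_forall_add_eq_of_coprime h1
    (f := fun j => v j + v (j + (a + 3 : ℕ))) hw
  have hsum : ∑ j, (v j + v (j + (a + 3 : ℕ))) = 0 := by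
    have h : ∑ j, v (j + (a + 3 : ℕ)) = ∑ j, v j :=
      Equiv.sum_comp (Equiv.addRight ((a + 3 : ℕ) : ZMod (2 * (a + b) + 7))) v
    rw [Finset.sum_add_distrib, h, CharTwo.add_self_eq_zero]
  have hodd : ((2 * (a + b) + 7 : ℕ) : ZMod 2) = 1 :=
    ZMod.natCast_eq_one_iff_odd.mpr ⟨a + b + 3, by ring⟩
  rw [Finset.sum_congr rfl fun j _ => hconst j, Finset.sum_const, Finset.card_univ, ZMod.card,
    nsmul_eq_mul, hodd, one_mul] at hsum
  have hv0 := ZMod.eq_of_forall_add_eq_of_coprime h2 (f := v) fun j =>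
    (CharTwo.add_eq_zero.mp ((hconst j).trans hsum)).symm
  have h01 : ∀ x : ZMod 2, x = 0 ∨ x = 1 := by decide
  exact (h01 (v 0)).imp (fun h => funext fun i => (hv0 i).trans h) fun h i => (hv0 i).trans h
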